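/- arXiv:1508.04207 — 2 statements merged into one kernel-verified Lean document; each statement's English description precedes it below -/
import Mathlib

section
/- Let A₁ ∈ R^{n×n} have all eigenvalues on the imaginary axis and (A₁,B₁) be controllable. Then for every γ > 0 the algebraic Riccati equation A₁ᵀP + PA₁ − PB₁B₁ᵀP = −γP has a positive definite solution P. -/
open Matrix

open Filter Topology NNReal ENNReal in
/-- In a complex Banach algebra, the powers of an element of spectral radius less than one tend to
zero. -/
theorem tendsto_pow_zero_of_spectralRadius_lt_one {A : Type*} [NormedRing A] [NormedAlgebra ℂ A]
    [CompleteSpace A] {a : A} (ha : spectralRadius ℂ a < 1) :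
    Tendsto (fun k : ℕ => a ^ k) atTop (𝓝 0) := by
  obtain ⟨r, har, hr⟩ := ENNReal.lt_iff_exists_nnreal_btwn.mp ha
  have hr1 : (r : ℝ) < 1 := by exact_mod_cast hr
  have hlt := (spectrum.pow_nnnorm_pow_one_div_tendsto_nhds_spectralRadius a).eventually_lt_const har
  refine squeeze_zero_norm' ?_ (tendsto_pow_atTop_nhds_zero_of_lt_one r.2 hr1)
  filter_upwards [hlt, eventually_gt_atTop 0] with k hk hk0
  have hk0' : (0 : ℝ) < k := by exact_mod_cast hk0
  have h := ENNReal.rpow_le_rpow hk.le hk0'.le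
  rw [← ENNReal.rpow_mul, one_div, inv_mul_cancel₀ hk0'.ne', ENNReal.rpow_one,
    ENNReal.rpow_natCast] at h
  exact_mod_cast h

namespace Matrix

variable {ι : Type*} [Fintype ι] [DecidableEq ι]

open Filter Topology

open scoped Matrix.Norms.Operator in
/-- The powers of a complex matrix with spectrum in the open unit disc tend to zero. -/
theorem tendsto_pow_zero_of_spectrum_complex [Nonempty ι] {C : Matrix ι ι ℂ}
    (hC : ∀ μ ∈ spectrum ℂ C, ‖μ‖ < 1) : Tendsto (fun k : ℕ => C ^ k) atTop (𝓝 0) := by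
  have : CompleteSpace (Matrix ι ι ℂ) := FiniteDimensional.complete ℂ _
  refine tendsto_pow_zero_of_spectralRadius_lt_one ?_
  exact_mod_cast spectrum.spectralRadius_lt_of_forall_lt C (r := 1)
    fun μ hμ => by exact_mod_cast hC μ hμ

/-- The powers of a real matrix with complex spectrum in the open unit disc tend to zero. -/
theorem tendsto_pow_zero_of_spectrum [Nonempty ι] {C : Matrix ι ι ℝ}
    (hC : ∀ μ ∈ spectrum ℂ (C.map (algebraMap ℝ ℂ)), ‖μ‖ < 1) :
    Tendsto (fun k : ℕ => C ^ k) atTop (𝓝 0) := by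
  have h := tendsto_pow_zero_of_spectrum_complex hC
  have hcont : Continuous fun M : Matrix ι ι ℂ => M.map Complex.re :=
    continuous_id.matrix_map Complex.continuous_re
  have h2 := (hcont.tendsto 0).comp h
  have h0 : (0 : Matrix ι ι ℂ).map Complex.re = 0 := by ext; simp
  rw [h0] at h2
  refine h2.congr fun k => ?_
  have : (C.map (algebraMap ℝ ℂ)) ^ k = (C ^ k).map (algebraMap ℝ ℂ) :=
    (map_pow (algebraMap ℝ ℂ).mapMatrix C k).symm
  simp only [Function.comp_apply, this]
  ext i j
  simp

/-- The conjugates of a fixed matrix by the powers of `C` tend to zero if those powers do. -/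
theorem tendsto_pow_mul_mul_pow_transpose {C : Matrix ι ι ℝ}
    (hC : Tendsto (fun k : ℕ => C ^ k) atTop (𝓝 0)) (V : Matrix ι ι ℝ) :
    Tendsto (fun k : ℕ => C ^ k * V * (C ^ k)ᵀ) atTop (𝓝 0) := by
  have hcont : Continuous fun M : Matrix ι ι ℝ => M * V * Mᵀ := by fun_prop
  simpa [Function.comp_def] using (hcont.tendsto 0).comp hC

/-- The homogeneous Stein equation of a stable matrix has only the trivial solution. -/
theorem eq_zero_of_stein {C V : Matrix ι ι ℝ}
    (hC : Tendsto (fun k : ℕ => C ^ k) atTop (𝓝 0)) (hV : V = C * V * Cᵀ) : V = 0 := by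
  have h : ∀ k : ℕ, C ^ k * V * (C ^ k)ᵀ = V := by
    intro k
    induction k with
    | zero => simp
    | succ k ih =>
      rw [pow_succ, transpose_mul]
      calc C ^ k * C * V * (Cᵀ * (C ^ k)ᵀ) = C ^ k * (C * V * Cᵀ) * (C ^ k)ᵀ := by
            simp only [mul_assoc]
        _ = V := by rw [← hV, ih]
  have := tendsto_pow_mul_mul_pow_transpose hC V
  simp only [h] at this
  exact tendsto_nhds_unique tendsto_const_nhds this

/-- Symmetric solutions of a Stein equation with positive semidefinite right-hand side and stable
coefficient are positive semidefinite. -/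
theorem PosSemidef.of_stein {C V : Matrix ι ι ℝ}
    (hC : Tendsto (fun k : ℕ => C ^ k) atTop (𝓝 0)) (hsymm : V.IsHermitian)
    (hV : (V - C * V * Cᵀ).PosSemidef) : V.PosSemidef := by
  have h : ∀ k : ℕ, (V - C ^ k * V * (C ^ k)ᵀ).PosSemidef := by
    intro k
    induction k with
    | zero => simpa using PosSemidef.zero
    | succ k ih =>
      have h2 := ih.add (hV.mul_mul_conjTranspose_same (C ^ k))
      convert h2 using 1
      rw [pow_succ, transpose_mul, conjTranspose_eq_transpose_of_trivial]
      simp only [mul_sub, sub_mul, mul_assoc]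
      abel
  refine PosSemidef.of_dotProduct_mulVec_nonneg hsymm fun x => ?_
  have hlim : Tendsto (fun k : ℕ => star x ⬝ᵥ ((V - C ^ k * V * (C ^ k)ᵀ) *ᵥ x)) atTop
      (𝓝 (star x ⬝ᵥ (V *ᵥ x))) := by
    have hcont : Continuous fun M : Matrix ι ι ℝ => star x ⬝ᵥ ((V - M) *ᵥ x) := by fun_prop
    simpa [Function.comp_def] using (hcont.tendsto 0).comp (tendsto_pow_mul_mul_pow_transpose hC V)
  exact ge_of_tendsto' hlim fun k => (h k).dotProduct_mulVec_nonneg x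

/-- A complex number with `(μ + 1) / (1 - μ)` in the right half plane lies in the unit disc. -/
theorem _root_.Complex.norm_lt_one_of_re_pos {μ : ℂ} (h : 0 < ((μ + 1) / (1 - μ)).re) :
    ‖μ‖ < 1 := by
  have hne : 1 - μ ≠ 0 := by
    intro h0
    simp [h0] at h
  have hpos : 0 < Complex.normSq (1 - μ) := Complex.normSq_pos.mpr hne
  rw [Complex.div_re, ← add_div, div_pos_iff_of_pos_right hpos] at h
  simp only [Complex.add_re, Complex.one_re, Complex.sub_re, Complex.add_im, Complex.one_im,
    Complex.sub_im] at h
  rw [← sq_lt_one_iff₀ (norm_nonneg μ), ← Complex.normSq_eq_norm_sq, Complex.normSq_apply]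
  nlinarith

section Lyapunov

variable {F : Matrix ι ι ℝ}

theorem isUnit_add_one_of_spectrum_re_pos
    (hF : ∀ μ ∈ spectrum ℂ (F.map (algebraMap ℝ ℂ)), 0 < μ.re) :
    IsUnit (F + 1) := by
  rw [isUnit_iff_isUnit_det, isUnit_iff_ne_zero]
  intro h0
  have hmem : (-1 : ℂ) ∈ spectrum ℂ (F.map (algebraMap ℝ ℂ)) := by
    rw [spectrum.mem_iff, isUnit_iff_isUnit_det, isUnit_iff_ne_zero, not_not]
    have : algebraMap ℂ (Matrix ι ι ℂ) (-1) - F.map (algebraMap ℝ ℂ)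
        = -((F + 1).map (algebraMap ℝ ℂ)) := by
      rw [Matrix.map_add _ (map_add _), Matrix.map_one _ (map_zero _) (map_one _), map_neg, map_one]
      abel
    rw [this, det_neg, ← RingHom.mapMatrix_apply, ← RingHom.map_det, h0]
    simp
  have := hF _ hmem
  norm_num at this

/-- The Cayley transform of a matrix with spectrum in the open right half plane is stable. -/
theorem tendsto_cayley_pow_zero [Nonempty ι]
    (hF : ∀ μ ∈ spectrum ℂ (F.map (algebraMap ℝ ℂ)), 0 < μ.re) :
    Tendsto (fun k : ℕ => ((F - 1) * (F + 1)⁻¹) ^ k) atTop (𝓝 0) := by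
  refine tendsto_pow_zero_of_spectrum fun μ hμ => ?_
  set G := F.map (algebraMap ℝ ℂ) with hG
  set C := ((F - 1) * (F + 1)⁻¹).map (algebraMap ℝ ℂ) with hCdef
  have hS := isUnit_add_one_of_spectrum_re_pos hF
  have hS' : IsUnit (G + 1) := by
    have := hS.map (algebraMap ℝ ℂ).mapMatrix
    rwa [map_add, map_one] at this
  have hCS : C * (G + 1) = G - 1 := by
    have h1 : (F - 1) * (F + 1)⁻¹ * (F + 1) = F - 1 := by
      rw [mul_assoc, nonsing_inv_mul _ ((isUnit_iff_isUnit_det _).mp hS), mul_one]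
    have := congrArg (algebraMap ℝ ℂ).mapMatrix h1
    rwa [map_mul, map_add, map_sub, map_one] at this
  have hnot : ¬ IsUnit ((μ • (1 : Matrix ι ι ℂ) - C) * (G + 1)) := by
    rw [spectrum.mem_iff, Algebra.algebraMap_eq_smul_one] at hμ
    rwa [hS'.mul_right_iff]
  have hexp : (μ • (1 : Matrix ι ι ℂ) - C) * (G + 1) = (μ + 1) • 1 - (1 - μ) • G := by
    rw [sub_mul, hCS, smul_mul_assoc, one_mul]
    module
  rw [hexp] at hnot
  have hne : 1 - μ ≠ 0 := by
    intro h0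
    have h1 : μ = 1 := (sub_eq_zero.mp h0).symm
    apply hnot
    rw [h0, zero_smul, sub_zero, h1, ← Algebra.algebraMap_eq_smul_one]
    exact (IsUnit.mk0 (1 + 1 : ℂ) (by norm_num)).map _
  refine Complex.norm_lt_one_of_re_pos (hF _ ?_)
  rw [spectrum.mem_iff, Algebra.algebraMap_eq_smul_one]
  intro hu
  apply hnot
  have := (IsUnit.mk0 _ hne).map (algebraMap ℂ (Matrix ι ι ℂ)) |>.mul hu
  rwa [← Algebra.smul_def, smul_sub, smul_smul, mul_div_cancel₀ _ hne] at this

/-- The Cayley transform turns the Lyapunov operator into a Stein operator. -/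
theorem stein_of_lyapunov (hS : IsUnit (F + 1)) (W : Matrix ι ι ℝ) :
    (F + 1) * W * (F + 1)ᵀ - ((F - 1) * (F + 1)⁻¹) * ((F + 1) * W * (F + 1)ᵀ) *
      ((F - 1) * (F + 1)⁻¹)ᵀ = (2 : ℝ) • (F * W + W * Fᵀ) := by
  have h1 : (F - 1) * (F + 1)⁻¹ * (F + 1) = F - 1 := by
    rw [mul_assoc, nonsing_inv_mul _ ((isUnit_iff_isUnit_det _).mp hS), mul_one]
  have h2 : ((F - 1) * (F + 1)⁻¹) * ((F + 1) * W * (F + 1)ᵀ) * ((F - 1) * (F + 1)⁻¹)ᵀ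
      = ((F - 1) * (F + 1)⁻¹ * (F + 1)) * W * ((F - 1) * (F + 1)⁻¹ * (F + 1))ᵀ := by
    rw [transpose_mul ((F - 1) * (F + 1)⁻¹) (F + 1)]
    simp only [mul_assoc]
  rw [h2, h1, transpose_add, transpose_sub, transpose_one]
  simp only [add_mul, sub_mul, mul_add, mul_sub, one_mul, mul_one, two_smul]
  abel

/-- The Lyapunov operator of a matrix with spectrum in the open right half plane is injective. -/
theorem eq_zero_of_lyapunov [Nonempty ι]
    (hF : ∀ μ ∈ spectrum ℂ (F.map (algebraMap ℝ ℂ)), 0 < μ.re)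
    {W : Matrix ι ι ℝ} (hW : F * W + W * Fᵀ = 0) :
    W = 0 := by
  have hS := isUnit_add_one_of_spectrum_re_pos hF
  have h := stein_of_lyapunov hS W
  rw [hW, smul_zero, sub_eq_zero] at h
  have h0 := eq_zero_of_stein (tendsto_cayley_pow_zero hF) h
  have hST : IsUnit (F + 1)ᵀ := (isUnit_transpose _).mpr hS
  rwa [hST.mul_left_eq_zero, hS.mul_right_eq_zero] at h0

/-- The Lyapunov equation of a matrix with spectrum in the open right half plane and positive
semidefinite right-hand side has a positive semidefinite solution. -/
theorem exists_posSemidef_lyapunov [Nonempty ι]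
    (hF : ∀ μ ∈ spectrum ℂ (F.map (algebraMap ℝ ℂ)), 0 < μ.re)
    {Q : Matrix ι ι ℝ} (hQ : Q.PosSemidef) :
    ∃ W : Matrix ι ι ℝ, W.PosSemidef ∧ F * W + W * Fᵀ = Q := by
  let L : Matrix ι ι ℝ →ₗ[ℝ] Matrix ι ι ℝ :=
    LinearMap.mulLeft ℝ F + LinearMap.mulRight ℝ Fᵀ
  have hL : ∀ W, L W = F * W + W * Fᵀ := fun _ => rfl
  have hinj : Function.Injective L :=
    (injective_iff_map_eq_zero L).mpr fun W hW => eq_zero_of_lyapunov hF (by rwa [← hL])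
  obtain ⟨W, hW⟩ := LinearMap.injective_iff_surjective.mp hinj Q
  have hQsymm : Qᵀ = Q := by simpa using hQ.isHermitian.eq
  have hsymm : Wᵀ = W := by
    apply hinj
    rw [hW, hL]
    rw [hL] at hW
    have := congrArg transpose hW
    rw [transpose_add, transpose_mul, transpose_mul, transpose_transpose, hQsymm, add_comm] at this
    exact this
  have hS := isUnit_add_one_of_spectrum_re_pos hF
  refine ⟨W, ?_, hW⟩
  have hV : ((F + 1) * W * (F + 1)ᵀ).PosSemidef := by
    refine PosSemidef.of_stein (tendsto_cayley_pow_zero hF) ?_ ?_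
    · rw [IsHermitian, conjTranspose_eq_transpose_of_trivial]
      simp only [transpose_mul, transpose_transpose, hsymm, mul_assoc]
    · rw [stein_of_lyapunov hS, ← hL, hW]
      exact hQ.smul (by norm_num)
  exact hS.posSemidef_star_right_conjugate_iff.mp hV

end Lyapunov

/-- If `(A, B)` is controllable, no nonzero row vector is annihilated by all `A ^ k * B`. -/
theorem eq_zero_of_controllable {n m : ℕ} {A : Matrix (Fin n) (Fin n) ℝ}
    {B : Matrix (Fin n) (Fin m) ℝ}
    (hctrb : (Matrix.of fun i (jk : Fin n × Fin m) =>
      ((A ^ (jk.1 : ℕ)) * B) i jk.2).rank = n) {x : Fin n → ℝ}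
    (hx : ∀ k : ℕ, x ᵥ* (A ^ k * B) = 0) : x = 0 := by
  rw [rank_eq_finrank_span_row] at hctrb
  have hinj := vecMul_injective_iff.mpr
    (linearIndependent_iff_card_eq_finrank_span.mpr (by rw [Fintype.card_fin]; exact hctrb.symm))
  apply hinj
  ext jk
  simpa [vecMul, dotProduct] using congrFun (hx jk.1) jk.2

/-- A positive semidefinite solution of the Lyapunov equation of a controllable pair is positive
definite. -/
theorem PosSemidef.posDef_of_lyapunov {n m : ℕ} {A : Matrix (Fin n) (Fin n) ℝ}
    {B : Matrix (Fin n) (Fin m) ℝ}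
    (hctrb : (Matrix.of fun i (jk : Fin n × Fin m) =>
      ((A ^ (jk.1 : ℕ)) * B) i jk.2).rank = n) {W : Matrix (Fin n) (Fin n) ℝ} {γ : ℝ}
    (hW : W.PosSemidef) (h : A * W + W * Aᵀ + γ • W = B * Bᵀ) : W.PosDef := by
  have hsymm : Wᵀ = W := by simpa using hW.isHermitian.eq
  have hleft : ∀ x, W *ᵥ x = 0 → x ᵥ* W = 0 := fun x hx => by
    rwa [← mulVec_transpose, hsymm]
  have hB : ∀ x, W *ᵥ x = 0 → Bᵀ *ᵥ x = 0 := by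
    intro x hx
    have h2 : x ⬝ᵥ ((A * W + W * Aᵀ + γ • W) *ᵥ x) = 0 := by
      simp [add_mulVec, ← mulVec_mulVec, hx, dotProduct_mulVec, hleft x hx, smul_mulVec]
    rw [h, ← mulVec_mulVec, dotProduct_mulVec, ← mulVec_transpose] at h2
    exact dotProduct_self_eq_zero.mp h2
  have hA : ∀ x, W *ᵥ x = 0 → W *ᵥ (Aᵀ *ᵥ x) = 0 := by
    intro x hx
    have h2 := congrArg (· *ᵥ x) h
    simpa [add_mulVec, ← mulVec_mulVec, hx, hB x hx, smul_mulVec] using h2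
  refine PosDef.of_dotProduct_mulVec_pos hW.isHermitian fun x hx => ?_
  refine lt_of_le_of_ne (hW.dotProduct_mulVec_nonneg x) fun h0 => hx ?_
  have hker : W *ᵥ x = 0 := (hW.dotProduct_mulVec_zero_iff x).mp h0.symm
  refine eq_zero_of_controllable hctrb fun k => ?_
  have hk : W *ᵥ (Aᵀ ^ k *ᵥ x) = 0 := by
    induction k with
    | zero => simpa using hker
    | succ k ih => simpa [pow_succ', ← mulVec_mulVec] using hA _ ih
  have := hB _ hk
  rwa [← mulVec_transpose, transpose_mul, transpose_pow, ← mulVec_mulVec]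

/-- Adding `c • 1` to a matrix with imaginary spectrum moves the spectrum to the line
`re = c`. -/
theorem re_eq_of_mem_spectrum_add_smul_one {A : Matrix ι ι ℝ}
    (hA : ∀ μ ∈ spectrum ℂ (A.map (algebraMap ℝ ℂ)), μ.re = 0) (c : ℝ) {μ : ℂ}
    (hμ : μ ∈ spectrum ℂ ((A + c • (1 : Matrix ι ι ℝ)).map (algebraMap ℝ ℂ))) : μ.re = c := by
  have hmap : (A + c • (1 : Matrix ι ι ℝ)).map (algebraMap ℝ ℂ)
      = A.map (algebraMap ℝ ℂ) + algebraMap ℂ (Matrix ι ι ℂ) c := by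
    ext i j
    by_cases hij : i = j <;> simp [Matrix.algebraMap_matrix_apply, hij]
  have hmem : μ - c ∈ spectrum ℂ (A.map (algebraMap ℝ ℂ)) := by
    rw [spectrum.mem_iff] at hμ ⊢
    rwa [hmap, ← sub_sub, sub_right_comm, ← map_sub] at hμ
  have := hA _ hmem
  simpa [sub_eq_zero] using this

end Matrix

/-- if all eigenvalues of `A₁` lie on the imaginary axis and `(A₁,B₁)`
is controllable, then for every `γ > 0` the ARE
`A₁ᵀP + PA₁ − PB₁B₁ᵀP = −γP` has a positive definite solution `P`. -/
theorem stmt9 {n m : ℕ}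
    (A₁ : Matrix (Fin n) (Fin n) ℝ) (B₁ : Matrix (Fin n) (Fin m) ℝ)
    (hiR : ∀ μ ∈ spectrum ℂ (A₁.map (algebraMap ℝ ℂ)), μ.re = 0)
    (hctrb : (Matrix.of fun i (jk : Fin n × Fin m) =>
      ((A₁ ^ (jk.1 : ℕ)) * B₁) i jk.2).rank = n) :
    ∀ γ : ℝ, 0 < γ → ∃ P : Matrix (Fin n) (Fin n) ℝ, P.PosDef ∧
      A₁ᵀ * P + P * A₁ - P * B₁ * B₁ᵀ * P = -(γ • P) := by
  intro γ hγ
  rcases isEmpty_or_nonempty (Fin n) with _ | _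
  · exact ⟨1, PosDef.one, Subsingleton.elim _ _⟩
  have hF : ∀ μ ∈ spectrum ℂ ((A₁ + (γ / 2) • (1 : Matrix (Fin n) (Fin n) ℝ)).map
      (algebraMap ℝ ℂ)), 0 < μ.re := fun μ hμ => by
    rw [re_eq_of_mem_spectrum_add_smul_one hiR _ hμ]
    positivity
  obtain ⟨W, hW, hlyap⟩ := exists_posSemidef_lyapunov hF (posSemidef_self_mul_conjTranspose B₁)
  rw [conjTranspose_eq_transpose_of_trivial] at hlyap
  have hlyap' : A₁ * W + W * A₁ᵀ + γ • W = B₁ * B₁ᵀ := by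
    rw [← hlyap, transpose_add, transpose_smul, transpose_one]
    simp only [add_mul, mul_add, smul_mul_assoc, mul_smul_comm, one_mul, mul_one]
    module
  have hPD := hW.posDef_of_lyapunov hctrb hlyap'
  have hdet : IsUnit W.det := (isUnit_iff_isUnit_det _).mp hPD.isUnit
  refine ⟨W⁻¹, hPD.inv, ?_⟩
  have h1 : W⁻¹ * B₁ * B₁ᵀ * W⁻¹ = W⁻¹ * (B₁ * B₁ᵀ) * W⁻¹ := by simp only [Matrix.mul_assoc]
  rw [h1, ← hlyap']
  have h2 : W⁻¹ * (A₁ * W + W * A₁ᵀ + γ • W) * W⁻¹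
      = W⁻¹ * A₁ * (W * W⁻¹) + (W⁻¹ * W) * A₁ᵀ * W⁻¹ + γ • ((W⁻¹ * W) * W⁻¹) := by
    simp only [mul_add, add_mul, mul_smul_comm, smul_mul_assoc, mul_assoc]
  rw [h2, mul_nonsing_inv _ hdet, nonsing_inv_mul _ hdet, mul_one, one_mul, one_mul]
  abel
end

section
/- Suppose (C,A) is detectable and −H is Hurwitz with H ∈ R^{N×N}. Then there exists L ∈ R^{n×p} such that I_N⊗A − H⊗LC is Hurwitz. -/
open Matrix Kronecker

/-- A linear functional on square matrices is given by pairing with a matrix. -/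
lemma exists_matrix_of_functional {n : ℕ} (g : Matrix (Fin n) (Fin n) ℝ →ₗ[ℝ] ℝ) :
    ∃ Z : Matrix (Fin n) (Fin n) ℝ, ∀ x y, g (vecMulVec x y) = x ⬝ᵥ Z *ᵥ y := by
  refine ⟨of fun i j => g (single i j 1), fun x y => ?_⟩
  conv_lhs => rw [matrix_eq_sum_single (vecMulVec x y)]
  simp only [map_sum, dotProduct, mulVec, Finset.mul_sum, of_apply]
  refine Finset.sum_congr rfl fun i _ => Finset.sum_congr rfl fun j _ => ?_
  have : single i j (vecMulVec x y i j) = (x i * y j) • (single i j 1 : Matrix _ _ ℝ) := by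
    simp [smul_single, vecMulVec_apply]
  rw [this, map_smul, smul_eq_mul]
  ring

lemma vecMulVec_quadratic {n : ℕ} (x y z : Fin n → ℝ) :
    z ⬝ᵥ vecMulVec x y *ᵥ z = (z ⬝ᵥ x) * (y ⬝ᵥ z) := by
  rw [vecMulVec_mulVec]
  simp [dotProduct, Finset.sum_mul, mul_assoc]

lemma exists_quadratic_lower_bound {n : ℕ} (M : Matrix (Fin n) (Fin n) ℝ) :
    ∃ K : ℝ, ∀ x, 0 ≤ K * (x ⬝ᵥ x) + x ⬝ᵥ M *ᵥ x := by
  refine ⟨∑ i, ∑ j, |M i j|, fun x => ?_⟩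
  have key : ∀ i j, 0 ≤ |M i j| * (x ⬝ᵥ x) + x i * (M i j * x j) := by
    intro i j
    have h (k : Fin n) : x k * x k ≤ x ⬝ᵥ x :=
      Finset.single_le_sum (f := fun k => x k * x k) (fun k _ => mul_self_nonneg _)
        (Finset.mem_univ k)
    have h1 : |x i * x j| ≤ x ⬝ᵥ x := by
      rw [abs_le]
      constructor <;> nlinarith [h i, h j, mul_self_nonneg (x i + x j), mul_self_nonneg (x i - x j)]
    have h2 : |M i j * (x i * x j)| ≤ |M i j| * (x ⬝ᵥ x) := by
      rw [abs_mul]; gcongr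
    have := neg_abs_le (M i j * (x i * x j))
    linarith
  have : (∑ i, ∑ j, |M i j|) * (x ⬝ᵥ x) + x ⬝ᵥ M *ᵥ x
      = ∑ i, ∑ j, (|M i j| * (x ⬝ᵥ x) + x i * (M i j * x j)) := by
    simp only [Finset.sum_add_distrib, Finset.sum_mul]
    congr 1
    simp only [dotProduct, mulVec, Finset.mul_sum]
  rw [this]
  exact Finset.sum_nonneg fun i _ => Finset.sum_nonneg fun j _ => key i j

lemma dotProduct_transpose_mulVec_self {n : ℕ} (M : Matrix (Fin n) (Fin n) ℝ) (x : Fin n → ℝ) :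
    x ⬝ᵥ Mᵀ *ᵥ x = x ⬝ᵥ M *ᵥ x := by
  rw [mulVec_transpose, dotProduct_comm, ← dotProduct_mulVec]

/-- The pairs `(M₁, M₂)` for which the system `M₁ + X ⪰ 0`, `M₂ - (XA + AᵀX) + c CᵀC ⪰ 0` is
solvable in `(X, c)`. -/
def lyapunovCone {n p : ℕ} (A : Matrix (Fin n) (Fin n) ℝ) (C : Matrix (Fin p) (Fin n) ℝ) :
    PointedCone ℝ (Matrix (Fin n) (Fin n) ℝ × Matrix (Fin n) (Fin n) ℝ) where
  carrier := {M | ∃ (X : Matrix (Fin n) (Fin n) ℝ) (c : ℝ), ∀ x,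
    0 ≤ x ⬝ᵥ (M.1 + X) *ᵥ x ∧ 0 ≤ x ⬝ᵥ (M.2 - (X * A + Aᵀ * X) + c • (Cᵀ * C)) *ᵥ x}
  zero_mem' := ⟨0, 0, fun x => by simp⟩
  add_mem' := by
    rintro M M' ⟨X, c, h⟩ ⟨X', c', h'⟩
    refine ⟨X + X', c + c', fun x => ⟨?_, ?_⟩⟩
    · refine (add_nonneg (h x).1 (h' x).1).trans_eq ?_
      rw [← dotProduct_add, ← add_mulVec]
      congr 2
      simp only [Prod.fst_add]; abel
    · refine (add_nonneg (h x).2 (h' x).2).trans_eq ?_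
      rw [← dotProduct_add, ← add_mulVec]
      congr 2
      simp only [Prod.snd_add, add_mul, mul_add, add_smul]; abel
  smul_mem' := by
    rintro ⟨t, ht⟩ M ⟨X, c, h⟩
    refine ⟨t • X, t * c, fun x => ⟨?_, ?_⟩⟩
    · refine (mul_nonneg ht (h x).1).trans_eq ?_
      rw [← smul_eq_mul t (_ ⬝ᵥ _), ← dotProduct_smul, ← smul_mulVec]
      congr 2
      change _ = t • M.1 + _
      rw [smul_add]
    · refine (mul_nonneg ht (h x).2).trans_eq ?_
      rw [← smul_eq_mul t (_ ⬝ᵥ _), ← dotProduct_smul, ← smul_mulVec]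
      congr 2
      change _ = t • M.2 - _ + _
      simp [smul_sub, smul_add, mul_smul]

/-- Alternative theorem for the Lyapunov inequality: either it is strictly feasible, or there is a
nonzero positive semidefinite certificate of infeasibility. -/
lemma lyapunov_alternative {n p : ℕ} (A : Matrix (Fin n) (Fin n) ℝ)
    (C : Matrix (Fin p) (Fin n) ℝ) :
    (∃ (X : Matrix (Fin n) (Fin n) ℝ) (c : ℝ), Xᵀ = X ∧ (∀ x, x ≠ 0 → 0 < x ⬝ᵥ X *ᵥ x) ∧
      ∀ x, x ≠ 0 → 2 * (x ⬝ᵥ (X * A) *ᵥ x) < c * (C *ᵥ x ⬝ᵥ C *ᵥ x)) ∨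
    ∃ Z : Matrix (Fin n) (Fin n) ℝ, Z ≠ 0 ∧ Z.PosSemidef ∧ (A * Z + Z * Aᵀ).PosSemidef ∧
      C * Z = 0 := by
  rcases Nat.eq_zero_or_pos n with rfl | hn
  · exact Or.inl ⟨0, 0, by simp, fun x hx => absurd (Subsingleton.elim x 0) hx,
      fun x hx => absurd (Subsingleton.elim x 0) hx⟩
  have : NeZero n := ⟨hn.ne'⟩
  let E := Matrix (Fin n) (Fin n) ℝ × Matrix (Fin n) (Fin n) ℝ
  by_cases hfeas : ∃ t : ℝ, t < 0 ∧ t • ((1, 1) : E) ∈ lyapunovCone A C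
  · left
    obtain ⟨t, ht, X, c, h⟩ := hfeas
    have hpos : ∀ x : Fin n → ℝ, x ≠ 0 → 0 < x ⬝ᵥ x := fun x hx =>
      lt_of_le_of_ne (Finset.sum_nonneg fun i _ => mul_self_nonneg _)
        fun h => hx (dotProduct_self_eq_zero.1 h.symm)
    refine ⟨(1 / 2 : ℝ) • (X + Xᵀ), c, by simp [add_comm], fun x hx => ?_, fun x hx => ?_⟩
    · have h1 := (h x).1
      simp only [Prod.smul_mk, add_mulVec, dotProduct_add, smul_mulVec, one_mulVec,
        dotProduct_smul, smul_eq_mul] at h1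
      simp only [add_mulVec, dotProduct_add, smul_mulVec, dotProduct_smul, smul_eq_mul,
        dotProduct_transpose_mulVec_self]
      nlinarith [hpos x hx]
    · have h2 := (h x).2
      have h3 : x ⬝ᵥ (Aᵀ * X) *ᵥ x = x ⬝ᵥ (Xᵀ * A) *ᵥ x := by
        rw [← dotProduct_transpose_mulVec_self]; simp
      have h4 : x ⬝ᵥ (Cᵀ * C) *ᵥ x = C *ᵥ x ⬝ᵥ C *ᵥ x := by
        rw [← mulVec_mulVec, dotProduct_mulVec, vecMul_transpose]
      simp only [Prod.smul_mk, add_mulVec, sub_mulVec, dotProduct_add, dotProduct_sub, smul_mulVec,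
        one_mulVec, dotProduct_smul, smul_eq_mul, h3, h4] at h2
      simp only [add_mulVec, add_mul, smul_mul, dotProduct_add, smul_mulVec, dotProduct_smul,
        smul_eq_mul]
      nlinarith [hpos x hx]
  right
  push Not at hfeas
  have hne : ((1, 1) : E) ≠ 0 := by simp [Prod.ext_iff]
  obtain ⟨g, hg1, hg⟩ := riesz_extension (lyapunovCone A C)
    (LinearPMap.mkSpanSingleton ((1, 1) : E) (1 : ℝ) hne) (by
      rintro ⟨x, hx⟩ hxs
      obtain ⟨t, rfl⟩ := Submodule.mem_span_singleton.1 hx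
      rw [LinearPMap.mkSpanSingleton'_apply]
      by_contra! hlt
      exact hfeas t (by simpa using hlt) hxs) (by
      rintro ⟨M₁, M₂⟩
      obtain ⟨K₁, hK₁⟩ := exists_quadratic_lower_bound M₁
      obtain ⟨K₂, hK₂⟩ := exists_quadratic_lower_bound M₂
      refine ⟨⟨max K₁ K₂ • ((1, 1) : E), Submodule.smul_mem _ _
        (Submodule.mem_span_singleton_self _)⟩, 0, 0, fun x => ?_⟩
      have hx : 0 ≤ x ⬝ᵥ x := Finset.sum_nonneg fun i _ => mul_self_nonneg _
      have h1 := mul_le_mul_of_nonneg_right (le_max_left K₁ K₂) hx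
      have h2 := mul_le_mul_of_nonneg_right (le_max_right K₁ K₂) hx
      simp only [Prod.smul_mk, Prod.mk_add_mk, add_mulVec, dotProduct_add, smul_mulVec,
        one_mulVec, dotProduct_smul, smul_eq_mul, add_zero, mul_zero, zero_mul, sub_zero,
        zero_smul]
      exact ⟨by linarith [hK₁ x], by linarith [hK₂ x]⟩)
  have hg11 : g (1, 1) = 1 := by
    have := hg1 ⟨(1, 1), Submodule.mem_span_singleton_self _⟩
    rwa [LinearPMap.mkSpanSingleton_apply] at this
  set g₂ : Matrix (Fin n) (Fin n) ℝ →ₗ[ℝ] ℝ := g ∘ₗ LinearMap.inr ℝ _ _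
  have hg₂nonneg : ∀ M, (∀ x, 0 ≤ x ⬝ᵥ M *ᵥ x) → 0 ≤ g₂ M := fun M hM =>
    hg _ ⟨0, 0, fun x => by simpa using hM x⟩
  have hg₁nonneg : ∀ M, (∀ x, 0 ≤ x ⬝ᵥ M *ᵥ x) → 0 ≤ g (M, 0) := fun M hM =>
    hg _ ⟨0, 0, fun x => by simpa using hM x⟩
  have hrel : ∀ X, g (X, 0) = g₂ (X * A + Aᵀ * X) := by
    intro X
    have h1 : 0 ≤ g (-X, X * A + Aᵀ * X) := hg _ ⟨X, 0, fun x => by simp⟩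
    have h2 : 0 ≤ g (X, -(X * A + Aᵀ * X)) := hg _ ⟨-X, 0, fun x => by simp [add_comm]⟩
    have e1 : ((-X, X * A + Aᵀ * X) : E) = -(X, 0) + (0, X * A + Aᵀ * X) := by simp
    have e2 : ((X, -(X * A + Aᵀ * X)) : E) = (X, 0) - (0, X * A + Aᵀ * X) := by simp
    rw [e1, map_add, map_neg] at h1
    rw [e2, map_sub] at h2
    exact le_antisymm (sub_nonneg.1 (h1.trans_eq (neg_add_eq_sub _ _))) (sub_nonneg.1 h2)
  have hCC : g₂ (Cᵀ * C) = 0 := by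
    have h1 : 0 ≤ g (0, Cᵀ * C) := hg _ ⟨0, -1, fun x => by simp⟩
    have h2 : 0 ≤ g (0, -(Cᵀ * C)) := hg _ ⟨0, 1, fun x => by simp⟩
    have e : ((0, -(Cᵀ * C)) : E) = -(0, Cᵀ * C) := by simp
    rw [e, map_neg] at h2
    exact le_antisymm (neg_nonneg.1 h2) h1
  have hdecomp : g (1, 0) + g₂ 1 = 1 := by
    rw [← hg11]
    change _ + g (0, 1) = _
    rw [← map_add]; simp
  obtain ⟨Z, hZ⟩ := exists_matrix_of_functional g₂
  have hsymm : ∀ x y, x ⬝ᵥ Z *ᵥ y = y ⬝ᵥ Z *ᵥ x := by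
    intro x y
    rw [← hZ, ← hZ, ← sub_eq_zero, ← map_sub]
    apply le_antisymm
    · rw [← neg_nonneg, ← map_neg]
      refine hg₂nonneg _ fun z => le_of_eq ?_
      rw [neg_mulVec, sub_mulVec, dotProduct_neg, dotProduct_sub, vecMulVec_quadratic,
        vecMulVec_quadratic, dotProduct_comm z x, dotProduct_comm z y]
      ring
    · refine hg₂nonneg _ fun z => le_of_eq ?_
      rw [sub_mulVec, dotProduct_sub, vecMulVec_quadratic,
        vecMulVec_quadratic, dotProduct_comm z x, dotProduct_comm z y]
      ring
  have hZT : Zᵀ = Z := by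
    ext i j
    have := hsymm (Pi.single i 1) (Pi.single j 1)
    simpa using this.symm
  have hvv : ∀ x z : Fin n → ℝ, 0 ≤ z ⬝ᵥ vecMulVec x x *ᵥ z := fun x z => by
    rw [vecMulVec_quadratic, dotProduct_comm z x]; exact mul_self_nonneg _
  have hZpsd : Z.PosSemidef := by
    refine .of_dotProduct_mulVec_nonneg (by simpa [IsHermitian] using hZT) fun x => ?_
    rw [star_trivial, ← hZ]
    exact hg₂nonneg _ (hvv x)
  refine ⟨Z, ?_, hZpsd, ?_, ?_⟩
  · rintro rfl
    have hz : g₂ = 0 := by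
      refine LinearMap.ext fun M => ?_
      rw [matrix_eq_sum_single M]
      simp only [map_sum, LinearMap.zero_apply, Finset.sum_const_zero]
      refine Finset.sum_eq_zero fun i _ => Finset.sum_eq_zero fun j _ => ?_
      rw [← mul_one (M i j), ← smul_eq_mul, ← smul_single, map_smul,
        single_eq_single_vecMulVec_single, hZ]
      simp
    rw [hrel, hz] at hdecomp
    simp at hdecomp
  · refine .of_dotProduct_mulVec_nonneg ?_ fun x => ?_
    · simp [IsHermitian, hZT, add_comm]
    · have := hg₁nonneg _ (hvv x)
      rw [hrel, vecMulVec_mul, mul_vecMulVec, map_add, hZ, hZ] at this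
      rw [star_trivial, add_mulVec, dotProduct_add, ← mulVec_mulVec, ← mulVec_mulVec,
        mulVec_transpose, dotProduct_mulVec x A, ← mulVec_transpose]
      rw [← mulVec_transpose] at this
      linarith
  · have hsum : Cᵀ * C = ∑ k, vecMulVec (C.row k) (C.row k) := by
      ext i j
      simp [mul_apply, Matrix.sum_apply, vecMulVec_apply]
    rw [hsum, map_sum, Finset.sum_eq_zero_iff_of_nonneg fun k _ => hg₂nonneg _ (hvv _)] at hCC
    have hk : ∀ k, Z *ᵥ C.row k = 0 := fun k => by
      have := hCC k (Finset.mem_univ k)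
      rw [hZ] at this
      exact (hZpsd.dotProduct_mulVec_zero_iff (C.row k)).1 (by simpa using this)
    ext k j
    have := congrFun (hk k) j
    rw [← hZT, mulVec_transpose] at this
    simpa [vecMul, mul_apply, dotProduct] using this

/-- The real part of the quadratic form of a real matrix at a complex vector. -/
lemma re_star_dotProduct_map_mulVec {n : ℕ} (M : Matrix (Fin n) (Fin n) ℝ) (v : Fin n → ℂ) :
    (star v ⬝ᵥ M.map (algebraMap ℝ ℂ) *ᵥ v).re =
      (fun i => (v i).re) ⬝ᵥ M *ᵥ (fun i => (v i).re) +
      (fun i => (v i).im) ⬝ᵥ M *ᵥ (fun i => (v i).im) := by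
  simp [dotProduct, mulVec, Complex.re_sum, Complex.im_sum, Finset.sum_add_distrib]

lemma re_or_im_ne_zero {n : ℕ} {v : Fin n → ℂ} (hv : v ≠ 0) :
    (fun i => (v i).re) ≠ 0 ∨ (fun i => (v i).im) ≠ 0 := by
  by_contra! h
  exact hv (funext fun i => Complex.ext (congrFun h.1 i) (congrFun h.2 i))

lemma im_star_dotProduct_map_mulVec {n : ℕ} {M : Matrix (Fin n) (Fin n) ℝ} (hM : Mᵀ = M)
    (v : Fin n → ℂ) : (star v ⬝ᵥ M.map (algebraMap ℝ ℂ) *ᵥ v).im = 0 := by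
  refine IsHermitian.im_star_dotProduct_mulVec_self (𝕜 := ℂ) ?_ v
  ext i j
  simpa using congrFun (congrFun hM i) j

/-- If `ker Z ⊆ ker Y` for real matrices then `Yᵀ` factors through `Zᵀ`. -/
lemma exists_transpose_eq_mul_of_ker_le {n : ℕ} {Z Y : Matrix (Fin n) (Fin n) ℝ}
    (h : ∀ x, Z *ᵥ x = 0 → Y *ᵥ x = 0) : ∃ D, Yᵀ = Zᵀ * D := by
  have key : ∀ j, ∃ w, Y j = Zᵀ *ᵥ w := by
    intro j
    have hmem : LinearMap.proj j ∘ₗ Y.mulVecLin ∈ LinearMap.range Z.mulVecLin.dualMap := by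
      rw [LinearMap.range_dualMap_eq_dualAnnihilator_ker, Submodule.mem_dualAnnihilator]
      intro x hx
      have := congrFun (h x (by simpa using hx)) j
      simpa using this
    obtain ⟨ψ, hψ⟩ := hmem
    refine ⟨fun i => ψ (Pi.single i 1), funext fun i => ?_⟩
    have h1 := LinearMap.congr_fun hψ (Pi.single i 1)
    simp only [LinearMap.dualMap_apply, mulVecLin_apply, LinearMap.comp_apply,
      LinearMap.proj_apply, mulVec_single_one] at h1
    rw [LinearMap.pi_apply_eq_sum_univ ψ] at h1
    simp only [col_apply, smul_eq_mul] at h1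
    rw [← h1]
    refine Finset.sum_congr rfl fun k _ => ?_
    change _ = Z k i * ψ (Pi.single k 1)
    congr 2
    ext l
    simp [Pi.single_apply, eq_comm]
  choose w hw using key
  refine ⟨of fun i j => w j i, ?_⟩
  ext i j
  simp [hw j, mulVec, dotProduct, mul_apply]

/-- A strict Lyapunov inequality is feasible for every detectable pair. -/
lemma exists_lyapunov_of_detectable {n p : ℕ} (A : Matrix (Fin n) (Fin n) ℝ)
    (C : Matrix (Fin p) (Fin n) ℝ)
    (hdet : ∀ lam : ℂ, 0 ≤ lam.re →
      (Matrix.fromRows (A.map (algebraMap ℝ ℂ) - lam • 1) (C.map (algebraMap ℝ ℂ))).rank = n) :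
    ∃ (X : Matrix (Fin n) (Fin n) ℝ) (c : ℝ), Xᵀ = X ∧ (∀ x, x ≠ 0 → 0 < x ⬝ᵥ X *ᵥ x) ∧
      ∀ x, x ≠ 0 → 2 * (x ⬝ᵥ (X * A) *ᵥ x) < c * (C *ᵥ x ⬝ᵥ C *ᵥ x) := by
  refine (lyapunov_alternative A C).resolve_right ?_
  rintro ⟨Z, hZ0, hZ, hW, hCZ⟩
  have hZT : Zᵀ = Z := by simpa [IsHermitian] using hZ.1
  obtain ⟨D, hD⟩ := exists_transpose_eq_mul_of_ker_le (Z := Z) (Y := Z * Aᵀ) fun x hx => by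
    have h1 : star x ⬝ᵥ (A * Z + Z * Aᵀ) *ᵥ x = 0 := by
      rw [star_trivial, add_mulVec, dotProduct_add, ← mulVec_mulVec, hx, ← mulVec_mulVec,
        dotProduct_mulVec x Z, ← mulVec_transpose, hZT, hx]
      simp
    have h2 := (hW.dotProduct_mulVec_zero_iff x).1 h1
    rwa [add_mulVec, ← mulVec_mulVec, hx, mulVec_zero, zero_add] at h2
  rw [transpose_mul, transpose_transpose, hZT] at hD
  set Ac := A.map (algebraMap ℝ ℂ) with hAc
  set Zc := Z.map (algebraMap ℝ ℂ) with hZc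
  have hDc : Ac * Zc = Zc * D.map (algebraMap ℝ ℂ) := by
    rw [hAc, hZc, ← Matrix.map_mul, ← Matrix.map_mul, hD]
  have hCZc : C.map (algebraMap ℝ ℂ) * Zc = 0 := by
    rw [hZc, ← Matrix.map_mul, hCZ]; simp
  let S := LinearMap.range Zc.mulVecLin
  have hinv : ∀ v ∈ S, Ac.mulVecLin v ∈ S := by
    rintro _ ⟨w, rfl⟩
    refine ⟨D.map (algebraMap ℝ ℂ) *ᵥ w, ?_⟩
    simp only [mulVecLin_apply, mulVec_mulVec, hDc]
  have hSne : Nontrivial S := by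
    rw [Submodule.nontrivial_iff_ne_bot]
    intro hbot
    rw [LinearMap.range_eq_bot] at hbot
    apply hZ0
    ext i j
    have := congrFun (LinearMap.congr_fun hbot (Pi.single j 1)) i
    simpa [hZc] using this
  obtain ⟨lam, hlam⟩ := Module.End.exists_eigenvalue (Ac.mulVecLin.restrict hinv)
  obtain ⟨⟨v, w, hw⟩, hv⟩ := hlam.exists_hasEigenvector
  have hv0 : v ≠ 0 := fun h => hv.2 (Subtype.ext h)
  have hAv : Ac *ᵥ v = lam • v := congrArg Subtype.val hv.apply_eq_smul
  rw [mulVecLin_apply] at hw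
  have hpsd : ∀ (M : Matrix (Fin n) (Fin n) ℝ), M.PosSemidef → ∀ x, 0 ≤ x ⬝ᵥ M *ᵥ x :=
    fun M hM x => by simpa using hM.dotProduct_mulVec_nonneg x
  have hs : 0 < (star w ⬝ᵥ Zc *ᵥ w).re := by
    rw [hZc, re_star_dotProduct_map_mulVec]
    refine lt_of_le_of_ne (add_nonneg (hpsd _ hZ _) (hpsd _ hZ _)) fun h => hv0 ?_
    have h' := (add_eq_zero_iff_of_nonneg (hpsd _ hZ _) (hpsd _ hZ _)).1 h.symm
    have h1 := (hZ.dotProduct_mulVec_zero_iff _).1 (by simpa using h'.1)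
    have h2 := (hZ.dotProduct_mulVec_zero_iff _).1 (by simpa using h'.2)
    rw [← hw]
    funext i
    have h1 := congrFun h1 i
    have h2 := congrFun h2 i
    apply Complex.ext
    · simpa [hZc, mulVec, dotProduct, Complex.re_sum] using h1
    · simpa [hZc, mulVec, dotProduct, Complex.im_sum] using h2
  have hre : 0 ≤ lam.re := by
    have h1 : star w ⬝ᵥ (A * Z).map (algebraMap ℝ ℂ) *ᵥ w = lam * (star w ⬝ᵥ Zc *ᵥ w) := by
      rw [Matrix.map_mul, ← mulVec_mulVec, hw, hAv, dotProduct_smul, smul_eq_mul]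
    have h2 := congrArg Complex.re h1
    rw [Complex.mul_re, im_star_dotProduct_map_mulVec hZT, mul_zero, sub_zero,
      re_star_dotProduct_map_mulVec] at h2
    have h3 : ∀ x, 0 ≤ x ⬝ᵥ (A * Z) *ᵥ x := fun x => by
      have h4 := hpsd _ hW x
      have h5 : x ⬝ᵥ (Z * Aᵀ) *ᵥ x = x ⬝ᵥ (A * Z) *ᵥ x := by
        rw [← dotProduct_transpose_mulVec_self, transpose_mul, hZT, transpose_transpose]
      rw [add_mulVec, dotProduct_add, h5] at h4
      linarith
    exact nonneg_of_mul_nonneg_left (h2 ▸ add_nonneg (h3 _) (h3 _)) hs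
  have hker : (fromRows (Ac - lam • 1) (C.map (algebraMap ℝ ℂ))) *ᵥ v = 0 := by
    rw [fromRows_mulVec, sub_mulVec, hAv, smul_mulVec, one_mulVec, sub_self, ← hw, mulVec_mulVec,
      hCZc, zero_mulVec]
    ext (i | i) <;> rfl
  have hrank := hdet lam hre
  have hrn := LinearMap.finrank_range_add_finrank_ker
    (fromRows (Ac - lam • 1) (C.map (algebraMap ℝ ℂ))).mulVecLin
  rw [Matrix.rank] at hrank
  rw [hrank, Module.finrank_fin_fun] at hrn
  have hbot := Submodule.finrank_eq_zero.1 (Nat.add_eq_left.1 hrn)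
  exact hv0 ((Submodule.mem_bot ℂ).1 (hbot ▸ (by simpa using hker)))

/-- Every eigenvalue of `I ⊗ A - H ⊗ G` is an eigenvalue of `A - λ G` for some eigenvalue `λ` of
`H`. -/
lemma exists_eigenvector_of_kronecker {n N : ℕ} (A G : Matrix (Fin n) (Fin n) ℂ)
    (H : Matrix (Fin N) (Fin N) ℂ) {μ : ℂ}
    (hμ : μ ∈ spectrum ℂ ((1 : Matrix (Fin N) (Fin N) ℂ) ⊗ₖ A - H ⊗ₖ G)) :
    ∃ lam ∈ spectrum ℂ H, ∃ v : Fin n → ℂ, v ≠ 0 ∧ (A - lam • G) *ᵥ v = μ • v := by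
  set M := (1 : Matrix (Fin N) (Fin N) ℂ) ⊗ₖ A - H ⊗ₖ G with hM
  let K := H ⊗ₖ (1 : Matrix (Fin n) (Fin n) ℂ)
  have hcomm : Commute (toLin' M) (toLin' K) := by
    have : M * K = K * M := by
      simp only [hM, K, sub_mul, mul_sub, ← mul_kronecker_mul, one_mul, mul_one]
    rw [Commute, SemiconjBy, Module.End.mul_eq_comp, Module.End.mul_eq_comp, ← toLin'_mul,
      ← toLin'_mul, this]
  rw [← spectrum_toLin', ← Module.End.hasEigenvalue_iff_mem_spectrum] at hμ
  have hmaps := Module.End.mapsTo_genEigenspace_of_comm hcomm μ 1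
  have : Nontrivial (Module.End.eigenspace (toLin' M) μ) :=
    (Submodule.nontrivial_iff_ne_bot).2 hμ
  obtain ⟨lam, hlam⟩ := Module.End.exists_eigenvalue ((toLin' K).restrict hmaps)
  obtain ⟨⟨v, hvM⟩, hv⟩ := hlam.exists_hasEigenvector
  have hv0 : v ≠ 0 := fun h => hv.2 (Subtype.ext h)
  have hKv : K *ᵥ v = lam • v := congrArg Subtype.val hv.apply_eq_smul
  have hMv : M *ᵥ v = μ • v := Module.End.mem_eigenspace_iff.1 hvM
  obtain ⟨V, rfl⟩ := vec_bijective.2 v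
  have hV0 : V ≠ 0 := fun h => hv0 (by simp [h])
  rw [kronecker_mulVec_vec, ← vec_smul, vec_inj, Matrix.one_mul] at hKv
  rw [hM, sub_mulVec, kronecker_mulVec_vec, kronecker_mulVec_vec, ← vec_smul, ← vec_sub, vec_inj,
    transpose_one, Matrix.mul_one, Matrix.mul_assoc, hKv, Matrix.mul_smul, ← Matrix.smul_mul,
    ← Matrix.sub_mul] at hMv
  obtain ⟨i, j, hij⟩ : ∃ i j, V i j ≠ 0 := by
    by_contra! h
    exact hV0 (by ext i j; exact h i j)
  refine ⟨lam, ?_, V.col j, fun h => hij (congrFun h i), ?_⟩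
  · rw [← spectrum_toLin', ← Module.End.hasEigenvalue_iff_mem_spectrum]
    refine Module.End.hasEigenvalue_of_hasEigenvector (x := V i) ⟨?_, fun h => hij (congrFun h j)⟩
    rw [Module.End.mem_eigenspace_iff, toLin'_apply]
    funext k
    have := congrFun (congrFun hKv i) k
    simpa [mul_apply, mulVec, dotProduct, mul_comm] using this
  · funext k
    exact congrFun (congrFun hMv k) j

/-- if `(C,A)` is detectable and `−H` is Hurwitz (all eigenvalues of
`H` have positive real part), then there exists `L` such that `I_N⊗A − H⊗LC` is
Hurwitz. -/
theorem stmt13 {n p N : ℕ}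
    (A : Matrix (Fin n) (Fin n) ℝ) (C : Matrix (Fin p) (Fin n) ℝ)
    (H : Matrix (Fin N) (Fin N) ℝ)
    (hdet : ∀ lam : ℂ, 0 ≤ lam.re →
      (Matrix.fromRows (A.map (algebraMap ℝ ℂ) - lam • 1) (C.map (algebraMap ℝ ℂ))).rank = n)
    (hH : ∀ μ ∈ spectrum ℂ (H.map (algebraMap ℝ ℂ)), 0 < μ.re) :
    ∃ L : Matrix (Fin n) (Fin p) ℝ,
      ∀ μ ∈ spectrum ℂ
        (((1 : Matrix (Fin N) (Fin N) ℝ) ⊗ₖ A - H ⊗ₖ (L * C)).map (algebraMap ℝ ℂ)),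
        μ.re < 0 := by
  obtain ⟨X, c, hXT, hX, hlyap⟩ := exists_lyapunov_of_detectable A C hdet
  have hXdet : IsUnit X.det := by
    rw [isUnit_iff_ne_zero]
    intro h
    obtain ⟨x, hx, hXx⟩ := exists_mulVec_eq_zero_iff.2 h
    have := hX x hx
    simp [hXx] at this
  obtain ⟨k, hk⟩ := ((Matrix.finite_spectrum (H.map (algebraMap ℝ ℂ))).image
    fun μ => c / (2 * μ.re)).bddAbove
  refine ⟨k • (X⁻¹ * Cᵀ), fun μ hμ => ?_⟩
  have hmap : ((1 : Matrix (Fin N) (Fin N) ℝ) ⊗ₖ A - H ⊗ₖ (k • (X⁻¹ * Cᵀ) * C)).map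
      (algebraMap ℝ ℂ) = (1 : Matrix (Fin N) (Fin N) ℂ) ⊗ₖ A.map (algebraMap ℝ ℂ) -
        H.map (algebraMap ℝ ℂ) ⊗ₖ (k • (X⁻¹ * Cᵀ) * C).map (algebraMap ℝ ℂ) := by
    ext ⟨i, i'⟩ ⟨j, j'⟩
    by_cases h : i = j <;> simp [kroneckerMap_apply, one_apply, h]
  rw [hmap] at hμ
  obtain ⟨lam, hlam, v, hv0, hv⟩ := exists_eigenvector_of_kronecker _ _ _ hμ
  have hclam : c ≤ 2 * k * lam.re := by
    have h1 := hk ⟨lam, hlam, rfl⟩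
    have h2 := hH lam hlam
    rw [div_le_iff₀ (by positivity)] at h1
    linarith
  have hXG : X * (k • (X⁻¹ * Cᵀ) * C) = k • (Cᵀ * C) := by
    rw [Matrix.smul_mul, Matrix.mul_smul, Matrix.mul_assoc, ← Matrix.mul_assoc X, mul_nonsing_inv _ hXdet,
      Matrix.one_mul]
  have hquad : star v ⬝ᵥ (X * A).map (algebraMap ℝ ℂ) *ᵥ v -
      lam * (star v ⬝ᵥ (k • (Cᵀ * C)).map (algebraMap ℝ ℂ) *ᵥ v) =
      μ * (star v ⬝ᵥ X.map (algebraMap ℝ ℂ) *ᵥ v) := by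
    have h := congrArg (fun u => star v ⬝ᵥ X.map (algebraMap ℝ ℂ) *ᵥ u) hv
    simp only [mulVec_smul, dotProduct_smul, smul_eq_mul] at h
    rw [← h, mulVec_mulVec, mul_sub, sub_mulVec, dotProduct_sub, Matrix.mul_smul, smul_mulVec,
      dotProduct_smul, smul_eq_mul, ← Matrix.map_mul, ← Matrix.map_mul, hXG]
  have hre := congrArg Complex.re hquad
  rw [Complex.sub_re, Complex.mul_re, Complex.mul_re, im_star_dotProduct_map_mulVec hXT,
    im_star_dotProduct_map_mulVec (by simp), re_star_dotProduct_map_mulVec,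
    re_star_dotProduct_map_mulVec, re_star_dotProduct_map_mulVec] at hre
  have hC : ∀ x, x ⬝ᵥ (k • (Cᵀ * C)) *ᵥ x = k * (C *ᵥ x ⬝ᵥ C *ᵥ x) := fun x => by
    rw [smul_mulVec, dotProduct_smul, smul_eq_mul, ← mulVec_mulVec, dotProduct_mulVec,
      vecMul_transpose]
  simp only [hC] at hre
  set a := fun i => (v i).re
  set b := fun i => (v i).im
  have hXnonneg : ∀ x, 0 ≤ x ⬝ᵥ X *ᵥ x := fun x => by
    rcases eq_or_ne x 0 with rfl | hx
    · simp
    · exact (hX x hx).le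
  have hle : ∀ x, 2 * (x ⬝ᵥ (X * A) *ᵥ x) ≤ c * (C *ᵥ x ⬝ᵥ C *ᵥ x) := fun x => by
    rcases eq_or_ne x 0 with rfl | hx
    · simp
    · exact (hlyap x hx).le
  have hCnonneg : ∀ x, 0 ≤ C *ᵥ x ⬝ᵥ C *ᵥ x := fun x =>
    Finset.sum_nonneg fun i _ => mul_self_nonneg _
  have hbd : ∀ x, c * (C *ᵥ x ⬝ᵥ C *ᵥ x) ≤ 2 * k * lam.re * (C *ᵥ x ⬝ᵥ C *ᵥ x) := fun x =>
    mul_le_mul_of_nonneg_right hclam (hCnonneg x)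
  by_contra! hneg
  have hrhs : 0 ≤ μ.re * (a ⬝ᵥ X *ᵥ a + b ⬝ᵥ X *ᵥ b) :=
    mul_nonneg hneg (add_nonneg (hXnonneg a) (hXnonneg b))
  rcases re_or_im_ne_zero hv0 with h | h
  · linarith [hlyap a h, hle b, hbd a, hbd b]
  · linarith [hlyap b h, hle a, hbd a, hbd b]
end
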